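/- Let t ≥ 1, n ≥ 1, and let R be an associative ring with 1 in which n·1 is invertible (the paper assumes 1/2 ∈ R; the invoked right Cayley–Hamilton theorem for index 2 requires 1/n ∈ R), satisfying the polynomial identity [[x₁,y₁],z₁]·[[x₂,y₂],z₂]⋯[[x_t,y_t],z_t] = 0. Let A be an n×n matrix over R, let D = R[[R,R],R]R, and let Ā be the image of A in Mₙ(R/D). Then for every choice of elements λ₀^{(2)}, λ₁^{(2)}, …, λ_{n²}^{(2)} ∈ R whose images in R/D are the corresponding coefficients of the second right characteristic polynomial p_{Ā,2}(x) = rdet_{(2)}(x·Iₙ − Ā) ∈ (R/D)[x] (in particular λ_{n²}^{(2)} may be taken to be n·((n−1)!)^{1+n}), the power Cayley–Hamilton identity ( Iₙ·λ₀^{(2)} + A·λ₁^{(2)} + ⋯ + A^{n²−1}·λ_{n²−1}^{(2)} + A^{n²}·λ_{n²}^{(2)} )^t = 0 holds, where A^i·λ denotes the product of A^i with the scalar matrix λ·Iₙ. -/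

import Mathlib

/-- The symmetric determinant. -/
def sdet {R : Type*} [Ring R] {n : ℕ} (A : Matrix (Fin n) (Fin n) R) : R :=
  ∑ α : Equiv.Perm (Fin n), ∑ β : Equiv.Perm (Fin n),
    ((Equiv.Perm.sign α * Equiv.Perm.sign β : ℤˣ) : ℤ) •
      (List.ofFn fun i => A (α i) (β i)).prod

/-- The symmetric adjoint. -/
def sadj {R : Type*} [Ring R] {n : ℕ} (A : Matrix (Fin (n + 1)) (Fin (n + 1)) R) :
    Matrix (Fin (n + 1)) (Fin (n + 1)) R :=
  fun r s => (-1 : R) ^ ((r : ℕ) + (s : ℕ)) * sdet (A.submatrix s.succAbove r.succAbove)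

/-- `adjAux A j = (P_j, P₁ * ⋯ * P_j)` where `(P_j)` is the right adjoint sequence of `A`. -/
def adjAux {R : Type*} [Ring R] {n : ℕ} (A : Matrix (Fin (n + 1)) (Fin (n + 1)) R) :
    ℕ → Matrix (Fin (n + 1)) (Fin (n + 1)) R × Matrix (Fin (n + 1)) (Fin (n + 1)) R
  | 0 => (1, 1)
  | j + 1 =>
      let q := adjAux A j
      let p := sadj (A * q.2)
      (p, q.2 * p)

/-- The product `P₁ * ⋯ * P_k` of the right adjoint sequence of `A`. -/
def radjProd {R : Type*} [Ring R] {n : ℕ} (A : Matrix (Fin (n + 1)) (Fin (n + 1)) R)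
    (k : ℕ) : Matrix (Fin (n + 1)) (Fin (n + 1)) R :=
  (adjAux A k).2

/-- The `k`-th right adjoint `radj_{(k)}(A) = n • (P₁ * ⋯ * P_k)`. -/
def radj {R : Type*} [Ring R] {n : ℕ} (A : Matrix (Fin (n + 1)) (Fin (n + 1)) R)
    (k : ℕ) : Matrix (Fin (n + 1)) (Fin (n + 1)) R :=
  (n + 1) • radjProd A k

/-- The `k`-th right determinant `rdet_{(k)}(A) = tr (A * P₁ * ⋯ * P_k)`. -/
def rdet {R : Type*} [Ring R] {n : ℕ} (A : Matrix (Fin (n + 1)) (Fin (n + 1)) R)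
    (k : ℕ) : R :=
  (A * radjProd A k).trace

/-- The `k`-th right characteristic polynomial `p_{A,k}(x) = rdet_{(k)}(x Iₙ - A)`. -/
noncomputable def rcharpoly {R : Type*} [Ring R] {n : ℕ}
    (A : Matrix (Fin (n + 1)) (Fin (n + 1)) R) (k : ℕ) : Polynomial R :=
  rdet ((Polynomial.X : Polynomial R) • (1 : Matrix (Fin (n + 1)) (Fin (n + 1)) (Polynomial R))
    - A.map Polynomial.C) k

section SymmetricDeterminant

/-- The permutation of `Fin (n + 1)` sending `0` to `p` and `i.succ` to `p.succAbove (e i)`. -/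
def permSuccAbove {n : ℕ} (x : Fin (n + 1) × Equiv.Perm (Fin n)) : Equiv.Perm (Fin (n + 1)) :=
  x.1.cycleRange.symm * Equiv.Perm.decomposeFin.symm (0, x.2)

theorem permSuccAbove_zero {n : ℕ} (p : Fin (n + 1)) (e : Equiv.Perm (Fin n)) :
    permSuccAbove (p, e) 0 = p := by
  simp [permSuccAbove]

theorem permSuccAbove_succ {n : ℕ} (p : Fin (n + 1)) (e : Equiv.Perm (Fin n)) (i : Fin n) :
    permSuccAbove (p, e) i.succ = p.succAbove (e i) := by
  simp [permSuccAbove]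

theorem sign_permSuccAbove {n : ℕ} (p : Fin (n + 1)) (e : Equiv.Perm (Fin n)) :
    Equiv.Perm.sign (permSuccAbove (p, e)) = (-1) ^ (p : ℕ) * Equiv.Perm.sign e := by
  simp [permSuccAbove, Equiv.Perm.decomposeFin.symm_sign]

theorem permSuccAbove_bijective (n : ℕ) :
    Function.Bijective (permSuccAbove : Fin (n + 1) × Equiv.Perm (Fin n) → _) := by
  rw [Fintype.bijective_iff_injective_and_card]
  refine ⟨?_, by simp [Fintype.card_perm, Nat.factorial_succ]⟩
  rintro ⟨p, e⟩ ⟨q, f⟩ h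
  have hpq : p = q := by
    rw [← permSuccAbove_zero p e, h, permSuccAbove_zero]
  subst hpq
  refine Prod.ext rfl (Equiv.ext fun i => ?_)
  have := congrArg (fun σ : Equiv.Perm (Fin (n + 1)) => σ i.succ) h
  simpa only [permSuccAbove_succ, Fin.succAbove_right_inj] using this

theorem sum_perm_fin_succ {M : Type*} [AddCommMonoid M] {n : ℕ}
    (f : Equiv.Perm (Fin (n + 1)) → M) :
    ∑ α, f α = ∑ p, ∑ e, f (permSuccAbove (p, e)) := by
  rw [← Fintype.sum_prod_type' (f := fun p e => f (permSuccAbove (p, e)))]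
  exact (Fintype.sum_bijective _ (permSuccAbove_bijective n) _ _ fun _ => rfl).symm

variable {S : Type*} [Ring S] {n : ℕ}

/-- The part of the symmetric determinant of `A` in which the `k`-th factor is taken from
row `s`. -/
def sdetRow (A : Matrix (Fin n) (Fin n) S) (s k : Fin n) : S :=
  ∑ α : Equiv.Perm (Fin n), ∑ β : Equiv.Perm (Fin n),
    if α k = s then
      ((Equiv.Perm.sign α * Equiv.Perm.sign β : ℤˣ) : ℤ) •
        (List.ofFn fun i => A (α i) (β i)).prod
    else 0

theorem sum_sdetRow (A : Matrix (Fin n) (Fin n) S) (s : Fin n) :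
    ∑ k, sdetRow A s k = sdet A := by
  unfold sdetRow sdet
  rw [Finset.sum_comm]
  refine Finset.sum_congr rfl fun α _ => ?_
  rw [Finset.sum_comm]
  refine Finset.sum_congr rfl fun β _ => ?_
  rw [Finset.sum_eq_single (α.symm s)]
  · simp
  · intro k _ hk
    rw [if_neg]
    rintro rfl
    simp at hk
  · simp

theorem sdetRow_zero (A : Matrix (Fin (n + 1)) (Fin (n + 1)) S) (s : Fin (n + 1)) :
    sdetRow A s 0 =
      ∑ j, A s j * ((-1) ^ ((j : ℕ) + (s : ℕ)) *
        sdet (A.submatrix s.succAbove j.succAbove)) := by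
  have hpow : ∀ (m : ℕ) (x : S), (-1) ^ m * x = ((-1) ^ m : ℤ) • x := by
    intro m x
    simp [zsmul_eq_mul]
  unfold sdetRow sdet
  rw [sum_perm_fin_succ, Finset.sum_eq_single s]
  · simp only [permSuccAbove_zero, if_true]
    rw [Finset.sum_comm, sum_perm_fin_succ]
    refine Finset.sum_congr rfl fun j _ => ?_
    rw [Finset.sum_comm, hpow, mul_smul_comm, Finset.mul_sum, Finset.smul_sum]
    refine Finset.sum_congr rfl fun e _ => ?_
    rw [Finset.mul_sum, Finset.smul_sum]
    refine Finset.sum_congr rfl fun f _ => ?_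
    rw [mul_smul_comm, smul_smul, List.ofFn_succ, List.prod_cons]
    simp only [permSuccAbove_zero, permSuccAbove_succ, sign_permSuccAbove, Matrix.submatrix_apply]
    congr 1
    push_cast
    ring
  · intro p _ hp
    simp [permSuccAbove_zero, hp]
  · simp

theorem prod_ofFn_finRotate (f : Fin (n + 1) → S) :
    (List.ofFn fun i => f (finRotate (n + 1) i)).prod =
      (List.ofFn fun i : Fin n => f i.succ).prod * f 0 := by
  rw [List.ofFn_succ', List.concat_eq_append, List.prod_append]
  simp [Fin.coeSucc_eq_succ]

/-- An additive map is cyclic on the entries of `A` if it does not change when a product of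
entries, one for each position, is rotated. -/
def IsCyclicOn {G : Type*} [AddCommGroup G] (φ : S →+ G)
    (A : Matrix (Fin (n + 1)) (Fin (n + 1)) S) : Prop :=
  ∀ a b : Fin (n + 1) → Fin (n + 1),
    φ (List.ofFn fun i => A (a (finRotate (n + 1) i)) (b (finRotate (n + 1) i))).prod =
      φ (List.ofFn fun i => A (a i) (b i)).prod

theorem isCyclicOn_of_map_mul_comm {G : Type*} [AddCommGroup G] (φ : S →+ G)
    (h : ∀ x y, φ (x * y) = φ (y * x)) (A : Matrix (Fin (n + 1)) (Fin (n + 1)) S) :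
    IsCyclicOn φ A := by
  intro a b
  rw [prod_ofFn_finRotate (fun i => A (a i) (b i)), h, List.ofFn_succ, List.prod_cons]

theorem isCyclicOn_id_of_commute (A : Matrix (Fin (n + 1)) (Fin (n + 1)) S)
    (h : ∀ i j k l, Commute (A i j) (A k l)) : IsCyclicOn (AddMonoidHom.id S) A := by
  intro a b
  rw [prod_ofFn_finRotate (fun i => A (a i) (b i)), List.ofFn_succ, List.prod_cons]
  simp only [AddMonoidHom.id_apply]
  refine (Commute.list_prod_left _ _ fun x hx => ?_).eq
  obtain ⟨i, rfl⟩ := (List.mem_ofFn' _ _).1 hx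
  exact h _ _ _ _

variable {G : Type*} [AddCommGroup G] {φ : S →+ G}
  {A : Matrix (Fin (n + 1)) (Fin (n + 1)) S}

theorem IsCyclicOn.map_sdetRow (h : IsCyclicOn φ A) (s k : Fin (n + 1)) :
    φ (sdetRow A s k) = φ (sdetRow A s 0) := by
  have step : ∀ k, φ (sdetRow A s (finRotate (n + 1) k)) = φ (sdetRow A s k) := by
    intro k
    simp only [sdetRow, map_sum]
    refine Fintype.sum_equiv (Equiv.mulRight (finRotate (n + 1))) _ _ fun α => ?_
    refine Fintype.sum_equiv (Equiv.mulRight (finRotate (n + 1))) _ _ fun β => ?_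
    have hmul : Equiv.mulRight (finRotate (n + 1)) α k = α (finRotate (n + 1) k) := rfl
    by_cases hk : α (finRotate (n + 1) k) = s
    · rw [if_pos hk, if_pos (hmul.trans hk), map_zsmul, map_zsmul]
      simp only [Equiv.coe_mulRight, Equiv.Perm.coe_mul, Function.comp_apply]
      rw [h α β]
      congr 2
      simp only [Equiv.Perm.sign_mul]
      rw [mul_mul_mul_comm, Int.units_mul_self, mul_one]
    · rw [if_neg hk, if_neg (hmul ▸ hk)]
  induction k using Fin.induction with
  | zero => rfl
  | succ i ih =>
    rw [← ih, ← step i.castSucc, finRotate_apply, Fin.coeSucc_eq_succ]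

theorem IsCyclicOn.nsmul_map_sdetRow (h : IsCyclicOn φ A) (s : Fin (n + 1)) :
    (n + 1) • φ (sdetRow A s 0) = φ (sdet A) := by
  rw [← sum_sdetRow A s, map_sum, Finset.sum_congr rfl fun k _ => h.map_sdetRow s k]
  simp

theorem sdet_eq_zero_of_row_eq {m : ℕ} {B : Matrix (Fin m) (Fin m) S} {r s : Fin m} (hrs : r ≠ s)
    (h : B r = B s) : sdet B = 0 := by
  have hB : ∀ i, B (Equiv.swap r s i) = B i := by
    intro i
    rw [Equiv.swap_apply_def]
    split_ifs with h1 h2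
    · rw [h1, h]
    · rw [h2, h]
    · rfl
  refine Finset.sum_involution (fun α _ => Equiv.swap r s * α) ?_ ?_ ?_ ?_
  · intro α _
    rw [← Finset.sum_add_distrib]
    refine Finset.sum_eq_zero fun β _ => ?_
    simp [hB, Equiv.Perm.sign_swap hrs]
  · intro α _ _ hα
    exact hrs (Equiv.swap_eq_one_iff.1 (mul_eq_right.1 hα))
  · simp
  · intro α _
    simp [← mul_assoc]

theorem IsCyclicOn.nsmul_map_mul_sadj (h : IsCyclicOn φ A) (r s : Fin (n + 1)) :
    (n + 1) • φ ((A * sadj A) r s) = if r = s then φ (sdet A) else 0 := by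
  set ρ : Fin (n + 1) → Fin (n + 1) := fun i => if i = s then r else i with hρ
  set B := A.submatrix ρ id with hB
  have hcyc : IsCyclicOn φ B := fun a b => h (fun i => ρ (a i)) b
  have hentry : (A * sadj A) r s = sdetRow B s 0 := by
    rw [sdetRow_zero, Matrix.mul_apply]
    refine Finset.sum_congr rfl fun j _ => ?_
    have h1 : B s j = A r j := by simp [hB, hρ]
    have h2 : B.submatrix s.succAbove j.succAbove = A.submatrix s.succAbove j.succAbove := by
      ext i k
      simp [hB, hρ, Fin.succAbove_ne]
    rw [h1, h2]
    rfl
  rw [hentry, hcyc.nsmul_map_sdetRow s]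
  split_ifs with hrs
  · have : B = A := by
      ext i j
      by_cases hi : i = s <;> simp [hB, hρ, hi, hrs]
    rw [this]
  · rw [sdet_eq_zero_of_row_eq hrs, map_zero]
    funext j
    simp [hB, hρ]

end SymmetricDeterminant

section LieNilpotent

variable {S : Type*} [Ring S] {n : ℕ}

theorem commute_mul_sadj (hn : IsUnit ((n + 1 : ℕ) : S))
    (hS : ∀ a b c : S, Commute (a * b - b * a) c)
    (A : Matrix (Fin (n + 1)) (Fin (n + 1)) S) (i j k l : Fin (n + 1)) :
    Commute ((A * sadj A) i j) ((A * sadj A) k l) := by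
  let Z : AddSubgroup S := (Subring.center S).toAddSubgroup
  have hcyc : IsCyclicOn (QuotientAddGroup.mk' Z) A := by
    refine isCyclicOn_of_map_mul_comm _ (fun x y => ?_) A
    rw [← sub_eq_zero, ← map_sub]
    refine (QuotientAddGroup.eq_zero_iff _).2 ?_
    exact Subring.mem_center_iff.2 fun c => (hS x y c).symm.eq
  have hmem : ∀ r s, ∃ z ∈ Subring.center S,
      ((n + 1 : ℕ) : S) * (A * sadj A) r s = z + if r = s then sdet A else 0 := by
    intro r s
    refine ⟨((n + 1 : ℕ) : S) * (A * sadj A) r s - if r = s then sdet A else 0, ?_, by abel⟩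
    refine (QuotientAddGroup.eq_zero_iff (N := Z) _).1 ?_
    have := hcyc.nsmul_map_mul_sadj r s
    change QuotientAddGroup.mk' Z _ = 0
    rw [map_sub, ← nsmul_eq_mul, map_nsmul, this]
    split_ifs <;> simp
  obtain ⟨z, hz, hz'⟩ := hmem i j
  obtain ⟨w, hw, hw'⟩ := hmem k l
  have hcomm : Commute (((n + 1 : ℕ) : S) * (A * sadj A) i j)
      (((n + 1 : ℕ) : S) * (A * sadj A) k l) := by
    have hz1 : ∀ c, Commute z c := fun c => (Subring.mem_center_iff.1 hz c).symm
    have hw1 : ∀ c, Commute c w := fun c => Subring.mem_center_iff.1 hw c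
    rw [hz', hw']
    refine (hz1 _).add_left ((hw1 _).add_right ?_)
    split_ifs <;> simp
  generalize (A * sadj A) i j = x at *
  generalize (A * sadj A) k l = y at *
  refine hn.mul_left_cancel (hn.mul_left_cancel ?_)
  have hu : ∀ c, Commute ((n + 1 : ℕ) : S) c := fun c => Nat.cast_commute _ c
  have := hcomm.eq
  rw [mul_assoc, mul_assoc, ← mul_assoc x, ← mul_assoc y, ← (hu x).eq, ← (hu y).eq] at this
  simpa only [mul_assoc] using this

theorem mul_radj_two (hn : IsUnit ((n + 1 : ℕ) : S))
    (hS : ∀ a b c : S, Commute (a * b - b * a) c)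
    (A : Matrix (Fin (n + 1)) (Fin (n + 1)) S) :
    A * radj A 2 = rdet A 2 • (1 : Matrix (Fin (n + 1)) (Fin (n + 1)) S) := by
  have hprod : A * radjProd A 2 = (A * sadj A) * sadj (A * sadj A) := by
    simp [radjProd, adjAux, mul_assoc]
  have hcyc := isCyclicOn_id_of_commute (A * sadj A) (commute_mul_sadj hn hS A)
  have hentry : ∀ r s, (n + 1) • (A * radjProd A 2) r s =
      if r = s then sdet (A * sadj A) else 0 := by
    intro r s
    rw [hprod]
    exact hcyc.nsmul_map_mul_sadj r s
  have htrace : rdet A 2 = sdet (A * sadj A) := by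
    refine hn.mul_left_cancel ?_
    rw [← nsmul_eq_mul, ← nsmul_eq_mul, rdet, Matrix.trace, Finset.smul_sum]
    simp only [Matrix.diag_apply]
    rw [Finset.sum_congr rfl fun i _ => hentry i i]
    simp
  rw [radj, mul_smul_comm, htrace]
  ext r s
  rw [Matrix.smul_apply, hentry, Matrix.smul_apply, Matrix.one_apply]
  split_ifs <;> simp

open Polynomial in
theorem Polynomial.commute_commutator (hS : ∀ a b c : S, Commute (a * b - b * a) c)
    (p q r : S[X]) : Commute (p * q - q * p) r := by
  have hcoeff : ∀ m (c : S), Commute ((p * q - q * p).coeff m) c := by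
    intro m c
    rw [coeff_sub, coeff_mul, coeff_mul, ← Finset.Nat.sum_antidiagonal_swap (n := m)
      (f := fun x => q.coeff x.1 * p.coeff x.2), ← Finset.sum_sub_distrib]
    exact Commute.sum_left _ _ _ fun x _ => hS _ _ _
  ext m
  rw [coeff_mul, coeff_mul, ← Finset.Nat.sum_antidiagonal_swap]
  exact Finset.sum_congr rfl fun x _ => (hcoeff _ _).eq

end LieNilpotent

section Degree

open Polynomial

variable {S : Type*} [Ring S] {n : ℕ}

theorem natDegree_sdet_le (A : Matrix (Fin n) (Fin n) S[X]) (d : ℕ)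
    (h : ∀ i j, (A i j).natDegree ≤ d) : (sdet A).natDegree ≤ n * d := by
  refine natDegree_sum_le_of_forall_le _ _ fun α _ => ?_
  refine natDegree_sum_le_of_forall_le _ _ fun β _ => ?_
  refine (natDegree_smul_le _ _).trans ((natDegree_list_prod_le _).trans ?_)
  rw [List.map_ofFn, List.sum_ofFn]
  refine (Finset.sum_le_card_nsmul _ _ d fun i _ => h _ _).trans ?_
  simp

theorem natDegree_sadj_le (A : Matrix (Fin (n + 1)) (Fin (n + 1)) S[X]) (d : ℕ)
    (h : ∀ i j, (A i j).natDegree ≤ d) (i j : Fin (n + 1)) :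
    (sadj A i j).natDegree ≤ n * d := by
  have := natDegree_sdet_le (A.submatrix j.succAbove i.succAbove) d fun _ _ => h _ _
  unfold sadj
  rcases neg_one_pow_eq_or S[X] ((i : ℕ) + (j : ℕ)) with h | h <;> simpa [h] using this

theorem natDegree_matrix_mul_le (A B : Matrix (Fin n) (Fin n) S[X]) (d e : ℕ)
    (hA : ∀ i j, (A i j).natDegree ≤ d) (hB : ∀ i j, (B i j).natDegree ≤ e) (i j : Fin n) :
    ((A * B) i j).natDegree ≤ d + e := by
  rw [Matrix.mul_apply]
  exact natDegree_sum_le_of_forall_le _ _ fun k _ => natDegree_mul_le_of_le (hA _ _) (hB _ _)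

theorem natDegree_radj_two_lt (A : Matrix (Fin (n + 1)) (Fin (n + 1)) S[X])
    (h : ∀ i j, (A i j).natDegree ≤ 1) (i j : Fin (n + 1)) :
    (radj A 2 i j).natDegree < (n + 1) ^ 2 := by
  have hprod : radjProd A 2 = sadj A * sadj (A * sadj A) := by
    simp [radjProd, adjAux]
  have h1 := natDegree_sadj_le A 1 h
  have h2 := natDegree_sadj_le _ _ (natDegree_matrix_mul_le _ _ _ _ h h1)
  have h3 := natDegree_matrix_mul_le _ _ _ _ h1 h2 i j
  rw [radj, hprod, Matrix.smul_apply]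
  refine (natDegree_smul_le _ _).trans_lt (h3.trans_lt ?_)
  nlinarith

end Degree

section CayleyHamilton

open Polynomial

variable {S : Type*} [Ring S] {n : ℕ}

theorem sum_pow_mul_coeff_of_X_sub_mul_eq {m : ℕ} (A : Matrix (Fin m) (Fin m) S)
    (Q : Matrix (Fin m) (Fin m) S[X]) (p : S[X])
    (h : ((X : S[X]) • (1 : Matrix (Fin m) (Fin m) S[X]) - A.map C) * Q =
      p • (1 : Matrix (Fin m) (Fin m) S[X])) (N : ℕ) :
    ∑ i ∈ Finset.range (N + 1), A ^ i * (p.coeff i • (1 : Matrix (Fin m) (Fin m) S)) =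
      -(A ^ (N + 1) * Q.map fun q => q.coeff N) := by
  have hentry : ∀ r s, X * Q r s - ∑ j, C (A r j) * Q j s =
      p * (1 : Matrix (Fin m) (Fin m) S[X]) r s := by
    intro r s
    have := congrFun (congrFun h r) s
    rwa [sub_mul, smul_mul_assoc, one_mul, Matrix.sub_apply, Matrix.smul_apply,
      Matrix.smul_apply, Matrix.mul_apply, smul_eq_mul, smul_eq_mul] at this
  have hone : ∀ i r s, (p * (1 : Matrix (Fin m) (Fin m) S[X]) r s).coeff i =
      (p.coeff i • (1 : Matrix (Fin m) (Fin m) S)) r s := by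
    intro i r s
    by_cases hrs : r = s <;> simp [Matrix.one_apply, hrs]
  have hzero : p.coeff 0 • (1 : Matrix (Fin m) (Fin m) S) =
      -(A * Q.map fun q => q.coeff 0) := by
    ext r s
    rw [← hone, ← hentry]
    simp [Matrix.mul_apply]
  have hsucc : ∀ i, p.coeff (i + 1) • (1 : Matrix (Fin m) (Fin m) S) =
      (Q.map fun q => q.coeff i) - A * Q.map fun q => q.coeff (i + 1) := by
    intro i
    ext r s
    rw [← hone, ← hentry]
    simp [Matrix.mul_apply, coeff_X_mul]
  induction N with
  | zero => simp [hzero]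
  | succ N ih =>
    rw [Finset.sum_range_succ, ih, hsucc, mul_sub, ← mul_assoc, ← pow_succ]
    abel

theorem cayleyHamilton_rcharpoly_two (hn : IsUnit ((n + 1 : ℕ) : S))
    (hS : ∀ a b c : S, Commute (a * b - b * a) c)
    (A : Matrix (Fin (n + 1)) (Fin (n + 1)) S) :
    ∑ i ∈ Finset.range ((n + 1) ^ 2 + 1),
      A ^ i * ((rcharpoly A 2).coeff i • (1 : Matrix (Fin (n + 1)) (Fin (n + 1)) S)) = 0 := by
  have hn' : IsUnit ((n + 1 : ℕ) : S[X]) := by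
    simpa only [map_natCast] using hn.map (C : S →+* S[X])
  rw [sum_pow_mul_coeff_of_X_sub_mul_eq A _ (rcharpoly A 2)
    (mul_radj_two hn' (Polynomial.commute_commutator hS) _)]
  rw [neg_eq_zero]
  refine (congrArg _ (Matrix.ext fun r s => ?_)).trans (mul_zero (A ^ ((n + 1) ^ 2 + 1)))
  refine coeff_eq_zero_of_natDegree_lt (natDegree_radj_two_lt _ (fun i j => ?_) r s)
  rw [Matrix.sub_apply, Matrix.smul_apply, Matrix.one_apply, Matrix.map_apply]
  refine (natDegree_sub_le_of_le (m := 1) ?_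
    ((natDegree_C (A i j)).trans_le zero_le_one)).trans (max_self 1).le
  by_cases hij : i = j
  · simpa [hij] using natDegree_X_le (R := S)
  · simp [hij]

end CayleyHamilton

section DoubleCommutator

variable (R : Type*) [Ring R]

/-- The set of double commutators `[[a, b], c]`. -/
def doubleCommutators : Set R :=
  {u | ∃ a b c : R, u = (a * b - b * a) * c - c * (a * b - b * a)}

/-- The additive subgroup generated by the products `r * u₁ * ⋯ * u_k` with `r : R` and
double commutators `u₁, …, u_k`. -/
def doubleCommutatorPow : ℕ → AddSubgroup R
  | 0 => ⊤
  | k + 1 => AddSubgroup.closure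
      {v | ∃ w ∈ doubleCommutatorPow k, ∃ u ∈ doubleCommutators R, v = w * u}

variable {R}

theorem mul_mem_doubleCommutatorPow_succ {k : ℕ} {w u : R} (hw : w ∈ doubleCommutatorPow R k)
    (hu : u ∈ doubleCommutators R) : w * u ∈ doubleCommutatorPow R (k + 1) :=
  AddSubgroup.subset_closure ⟨w, hw, u, hu, rfl⟩

theorem commutator_mem_doubleCommutators {u : R} (hu : u ∈ doubleCommutators R) (r : R) :
    u * r - r * u ∈ doubleCommutators R := by
  obtain ⟨a, b, c, rfl⟩ := hu
  exact ⟨a * b - b * a, c, r, rfl⟩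

theorem doubleCommutatorPow_mul_mem {k : ℕ} {w : R} (hw : w ∈ doubleCommutatorPow R k) (r : R) :
    w * r ∈ doubleCommutatorPow R k := by
  induction k generalizing w r with
  | zero => exact AddSubgroup.mem_top _
  | succ k ih =>
    rw [doubleCommutatorPow] at hw
    induction hw using AddSubgroup.closure_induction with
    | mem x hx =>
      obtain ⟨w, hw, u, hu, rfl⟩ := hx
      have : w * u * r = w * r * u + w * (u * r - r * u) := by noncomm_ring
      rw [this]
      exact add_mem (mul_mem_doubleCommutatorPow_succ (ih hw r) hu)
        (mul_mem_doubleCommutatorPow_succ hw (commutator_mem_doubleCommutators hu r))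
    | zero => simp
    | add x y _ _ hx hy => rw [add_mul]; exact add_mem hx hy
    | neg x _ hx => rw [neg_mul]; exact neg_mem hx

theorem mul_mem_doubleCommutatorPow_of_mem_span {k : ℕ} {w d : R}
    (hw : w ∈ doubleCommutatorPow R k) (hd : d ∈ TwoSidedIdeal.span (doubleCommutators R)) :
    w * d ∈ doubleCommutatorPow R (k + 1) := by
  let I : TwoSidedIdeal R := .mk'
    {d | ∀ w ∈ doubleCommutatorPow R k, w * d ∈ doubleCommutatorPow R (k + 1)}
    (fun w _ => by simp)
    (fun {x y} hx hy w hw => by rw [mul_add]; exact add_mem (hx w hw) (hy w hw))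
    (fun {x} hx w hw => by rw [mul_neg]; exact neg_mem (hx w hw))
    (fun {x y} hy w hw => by
      rw [← mul_assoc]; exact hy _ (doubleCommutatorPow_mul_mem hw x))
    (fun {x y} hx w hw => by
      rw [← mul_assoc]; exact doubleCommutatorPow_mul_mem (hx w hw) y)
  have hI : TwoSidedIdeal.span (doubleCommutators R) ≤ I := by
    rw [TwoSidedIdeal.span_le]
    intro u hu
    simp only [I, SetLike.mem_coe, TwoSidedIdeal.mem_mk']
    exact fun w hw => mul_mem_doubleCommutatorPow_succ hw hu
  have := hI hd
  simp only [I, TwoSidedIdeal.mem_mk'] at this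
  exact this w hw

theorem list_prod_doubleCommutators_eq_zero {t : ℕ}
    (hPI : ∀ x y z : ℕ → R,
      ((List.range t).map fun i =>
        (x i * y i - y i * x i) * z i - z i * (x i * y i - y i * x i)).prod = 0)
    (l : List R) (hl : l.length = t) (hmem : ∀ u ∈ l, u ∈ doubleCommutators R) : l.prod = 0 := by
  have hget : ∀ i, l.getD i 0 ∈ doubleCommutators R := by
    intro i
    by_cases hi : i < l.length
    · rw [List.getD_eq_getElem _ _ hi]
      exact hmem _ (List.getElem_mem hi)
    · rw [List.getD_eq_default _ _ (not_lt.1 hi)]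
      exact ⟨0, 0, 0, by simp⟩
  choose x y z hxyz using hget
  rw [← hPI x y z]
  congr 1
  refine List.ext_getElem (by simp [hl]) fun i h1 h2 => ?_
  rw [List.getElem_map, List.getElem_range, ← hxyz, List.getD_eq_getElem _ _ h1]

theorem doubleCommutatorPow_eq_bot {t : ℕ}
    (hPI : ∀ x y z : ℕ → R,
      ((List.range t).map fun i =>
        (x i * y i - y i * x i) * z i - z i * (x i * y i - y i * x i)).prod = 0) :
    doubleCommutatorPow R t = ⊥ := by
  have key : ∀ k (l : List R), k + l.length = t → (∀ u ∈ l, u ∈ doubleCommutators R) →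
      ∀ w ∈ doubleCommutatorPow R k, w * l.prod = 0 := by
    intro k
    induction k with
    | zero =>
      intro l hl hmem w _
      rw [list_prod_doubleCommutators_eq_zero hPI l (by omega) hmem, mul_zero]
    | succ k ih =>
      intro l hl hmem w hw
      rw [doubleCommutatorPow] at hw
      induction hw using AddSubgroup.closure_induction with
      | mem x hx =>
        obtain ⟨w, hw, u, hu, rfl⟩ := hx
        rw [mul_assoc, ← List.prod_cons]
        refine ih (u :: l) (by simp; omega) (fun v hv => ?_) w hw
        rcases List.mem_cons.1 hv with rfl | hv
        · exact hu
        · exact hmem v hv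
      | zero => simp
      | add x y _ _ hx hy => rw [add_mul, hx, hy, add_zero]
      | neg x _ hx => rw [neg_mul, hx, neg_zero]
  rw [eq_bot_iff]
  intro w hw
  simpa using key t [] (by simp) (by simp) w hw

theorem matrix_pow_apply_mem_doubleCommutatorPow {m : ℕ} (M : Matrix (Fin m) (Fin m) R)
    (hM : ∀ i j, M i j ∈ TwoSidedIdeal.span (doubleCommutators R)) (k : ℕ) (i j : Fin m) :
    (M ^ k) i j ∈ doubleCommutatorPow R k := by
  induction k generalizing i j with
  | zero => exact AddSubgroup.mem_top _
  | succ k ih =>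
    rw [pow_succ, Matrix.mul_apply]
    exact sum_mem fun l _ => mul_mem_doubleCommutatorPow_of_mem_span (ih i l) (hM l j)

end DoubleCommutator

/-- **Power Cayley–Hamilton identity.** Let `R` satisfy
`[[x₁,y₁],z₁]⋯[[x_t,y_t],z_t] = 0` (`t ≥ 1`) with `1/n ∈ R`, let `A` be an `n×n` matrix
over `R` (`n ≥ 1`), let `D = R[[R,R],R]R`, and let `Ā` be the image of `A` over `R/D`.
If `λ₀,…,λ_{n²} ∈ R` have as images in `R/D` the corresponding coefficients of the second
right characteristic polynomial `p_{Ā,2}(x)`, then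
`(Iₙλ₀ + Aλ₁ + ⋯ + A^(n²)λ_{n²})^t = 0`. -/
theorem power_cayleyHamilton_of_doubleCommutator_PI
    (t n : ℕ) (ht : 1 ≤ t) (R : Type*) [Ring R] (hn : IsUnit ((n + 1 : ℕ) : R))
    (hPI : ∀ x y z : ℕ → R,
      ((List.range t).map fun i =>
        (x i * y i - y i * x i) * z i - z i * (x i * y i - y i * x i)).prod = 0)
    (A : Matrix (Fin (n + 1)) (Fin (n + 1)) R)
    (D : TwoSidedIdeal R)
    (hD : D = TwoSidedIdeal.span
      {u | ∃ a b c : R, u = (a * b - b * a) * c - c * (a * b - b * a)})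
    (lam : ℕ → R)
    (hlam : ∀ i, i ≤ (n + 1) ^ 2 →
      D.ringCon.mk' (lam i) = (rcharpoly (A.map D.ringCon.mk') 2).coeff i) :
    (∑ i ∈ Finset.range ((n + 1) ^ 2 + 1),
      A ^ i * (lam i • (1 : Matrix (Fin (n + 1)) (Fin (n + 1)) R))) ^ t = 0 := by
  have hker : ∀ x, D.ringCon.mk' x = 0 ↔ x ∈ D := fun x => by
    rw [TwoSidedIdeal.mem_iff, ← map_zero D.ringCon.mk']
    exact RingCon.eq _
  have hS : ∀ a b c : D.ringCon.Quotient, Commute (a * b - b * a) c := by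
    intro a b c
    obtain ⟨a, rfl⟩ := D.ringCon.mk'_surjective a
    obtain ⟨b, rfl⟩ := D.ringCon.mk'_surjective b
    obtain ⟨c, rfl⟩ := D.ringCon.mk'_surjective c
    rw [commute_iff_eq, ← sub_eq_zero]
    simp only [← map_mul, ← map_sub]
    rw [hker, hD]
    exact TwoSidedIdeal.subset_span ⟨a, b, c, rfl⟩
  have hunit : IsUnit ((n + 1 : ℕ) : D.ringCon.Quotient) := by
    simpa only [map_natCast] using hn.map D.ringCon.mk'
  have hCH := cayleyHamilton_rcharpoly_two hunit hS (A.map D.ringCon.mk')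
  set M := ∑ i ∈ Finset.range ((n + 1) ^ 2 + 1),
    A ^ i * (lam i • (1 : Matrix (Fin (n + 1)) (Fin (n + 1)) R)) with hM
  have hmap : D.ringCon.mk'.mapMatrix M = 0 := by
    rw [← hCH, hM, map_sum]
    refine Finset.sum_congr rfl fun i hi => ?_
    rw [map_mul, map_pow, ← hlam i (by simpa [Nat.lt_succ_iff] using hi)]
    congr 1
    ext r s
    by_cases hrs : r = s <;> simp [hrs]
  have hmem : ∀ i j, M i j ∈ TwoSidedIdeal.span (doubleCommutators R) := by
    intro i j
    have := (hker (M i j)).1 (congrFun (congrFun hmap i) j)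
    rwa [hD] at this
  ext i j
  have := matrix_pow_apply_mem_doubleCommutatorPow M hmem t i j
  rw [doubleCommutatorPow_eq_bot hPI] at this
  simpa using this
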